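/- Let s_n(x, y) ∈ ℤ[x, y] (n ≥ 1) be the Stern polynomials in two variables, defined by s_1(x, y) = 1, s_{2n}(x, y) = s_n(x, y), and s_{2n+1}(x, y) = x·s_n(x, y) + y·s_{n+1}(x, y) for all n ≥ 1. Then s_{n^R}(x, y) = s_n(x, y) for every n ≥ 1, where n^R is the base-2 digit reversal of n. -/

import Mathlib

open MvPolynomial

noncomputable def sternAct (d : ℕ) (p : MvPolynomial (Fin 2) ℤ × MvPolynomial (Fin 2) ℤ) :
    MvPolynomial (Fin 2) ℤ × MvPolynomial (Fin 2) ℤ :=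
  if d = 0 then (p.1, X 0 * p.1 + X 1 * p.2) else (X 0 * p.1 + X 1 * p.2, p.2)

noncomputable def sternB (p q : MvPolynomial (Fin 2) ℤ × MvPolynomial (Fin 2) ℤ) :
    MvPolynomial (Fin 2) ℤ :=
  X 0 * (X 0 - 1) * p.1 * q.1 + X 0 * X 1 * (p.1 * q.2 + p.2 * q.1) + X 1 * (X 1 - 1) * p.2 * q.2

lemma sternB_act (d : ℕ) (p q) : sternB (sternAct d p) q = sternB p (sternAct d q) := by
  unfold sternB sternAct
  split_ifs <;> ring

lemma sternB_foldr (w : List ℕ) : ∀ p q, sternB (w.foldr sternAct p) q =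
    sternB p (w.reverse.foldr sternAct q) := by
  induction w with
  | nil => intro p q; rfl
  | cons d w ih =>
    intro p q
    rw [List.foldr_cons, sternB_act, ih, List.reverse_cons, List.foldr_append]
    rfl

lemma stern_ne : (X 0 + X 1 - 1 : MvPolynomial (Fin 2) ℤ) ≠ 0 := by
  intro h
  have := congrArg (MvPolynomial.eval (fun _ => (1 : ℤ))) h
  simp at this

lemma stern_sym (w : List ℕ) :
    X 0 * (w.foldr sternAct (1, 1)).1 + X 1 * (w.foldr sternAct (1, 1)).2 =
    X 0 * (w.reverse.foldr sternAct (1, 1)).1 + X 1 * (w.reverse.foldr sternAct (1, 1)).2 := by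
  have h := sternB_foldr w (1, 1) (1, 1)
  apply mul_left_cancel₀ stern_ne
  unfold sternB at h
  linear_combination h

lemma ofDigits_pos_aux (w : List ℕ) : 1 ≤ Nat.ofDigits 2 (w ++ [1]) := by
  rw [Nat.ofDigits_append]
  have : 0 < 2 ^ w.length := by positivity
  simp [Nat.ofDigits_singleton]
  omega

lemma stern_foldr (s : ℕ → MvPolynomial (Fin 2) ℤ)
    (h1 : s 1 = 1)
    (h2 : ∀ n : ℕ, 1 ≤ n → s (2 * n) = s n)
    (h2a : ∀ n : ℕ, 1 ≤ n →
      s (2 * n + 1) = X 0 * s n + X 1 * s (n + 1)) (w : List ℕ) (hw : ∀ d ∈ w, d < 2) :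
    (s (Nat.ofDigits 2 (w ++ [1])), s (Nat.ofDigits 2 (w ++ [1]) + 1)) =
      w.foldr sternAct (1, 1) := by
  induction w with
  | nil =>
    have := h2 1 le_rfl
    simp [Nat.ofDigits_singleton, h1] at this ⊢
    exact this
  | cons d w ih =>
    have hd := hw d (by simp)
    have ih' := ih (fun e he => hw e (by simp [he]))
    have hp := ofDigits_pos_aux w
    rw [List.foldr_cons, ← ih', List.cons_append, Nat.ofDigits_cons]
    generalize Nat.ofDigits 2 (w ++ [1]) = m at hp
    unfold sternAct
    interval_cases d
    · simp [h2 m hp, h2a m hp]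
    · have e1 : 1 + 2 * m = 2 * m + 1 := by ring
      have e2 : 2 * m + 1 + 1 = 2 * (m + 1) := by ring
      simp [e1, e2, h2a m hp, h2 (m + 1) (by omega)]

/-- the two-variable Stern polynomials (elements of
ℤ[x, y] = MvPolynomial (Fin 2) ℤ, with X 0 playing the role of x and
X 1 that of y) are invariant under base-2 digit reversal. -/
theorem stern_polynomial_digit_reversal
    (s : ℕ → MvPolynomial (Fin 2) ℤ)
    (h1 : s 1 = 1)
    (h2 : ∀ n : ℕ, 1 ≤ n → s (2 * n) = s n)
    (h2a : ∀ n : ℕ, 1 ≤ n →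
      s (2 * n + 1) = X 0 * s n + X 1 * s (n + 1)) :
    ∀ n : ℕ, 1 ≤ n → s (Nat.ofDigits 2 (Nat.digits 2 n).reverse) = s n := by
  intro n
  induction n using Nat.strong_induction_on with
  | _ n ih =>
  intro hn
  obtain ⟨m, hm | hm⟩ : ∃ m, n = 2 * m ∨ n = 2 * m + 1 := ⟨n / 2, by omega⟩
  · have hm1 : 1 ≤ m := by omega
    have hd : Nat.digits 2 n = 0 :: Nat.digits 2 m := by
      rw [Nat.digits_def' (by norm_num) (by omega)]
      congr 2 <;> omega
    rw [hd, List.reverse_cons, Nat.ofDigits_append, hm, h2 m hm1, ← ih m (by omega) hm1]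
    simp
  · have hd : Nat.digits 2 n = 1 :: Nat.digits 2 m := by
      rw [Nat.digits_def' (by norm_num) (by omega)]
      congr 2 <;> omega
    rcases Nat.eq_zero_or_pos m with h0 | hm1
    · subst h0
      rw [hd, hm]; simp
    · have hne : Nat.digits 2 m ≠ [] := Nat.digits_ne_nil_iff_ne_zero.mpr (by omega)
      have hl : (Nat.digits 2 m).getLast hne = 1 := by
        have a := Nat.getLast_digit_ne_zero 2 (m := m) (by omega)
        have b := Nat.digits_lt_base (b := 2) (by norm_num) (List.getLast_mem hne)
        omega
      obtain ⟨w, hw⟩ : ∃ w, Nat.digits 2 m = w ++ [1] :=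
        ⟨(Nat.digits 2 m).dropLast, by rw [← hl, List.dropLast_append_getLast]⟩
      have hwd : ∀ d ∈ w, d < 2 := fun d hdw =>
        Nat.digits_lt_base (b := 2) (m := m) (by norm_num) (by rw [hw]; simp [hdw])
      have hmo : Nat.ofDigits 2 (w ++ [1]) = m := by rw [← hw, Nat.ofDigits_digits]
      have k1 := stern_foldr s h1 h2 h2a w hwd
      have k2 := stern_foldr s h1 h2 h2a w.reverse (fun d hd => hwd d (by simpa using hd))
      have hs := stern_sym w
      rw [← k1, ← k2, hmo] at hs
      have hr : Nat.ofDigits 2 (Nat.digits 2 n).reverse =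
          2 * Nat.ofDigits 2 (w.reverse ++ [1]) + 1 := by
        rw [hd, hw]
        simp [Nat.ofDigits_cons]
        ring
      rw [hr, h2a _ (ofDigits_pos_aux _), hm, h2a m hm1]
      exact hs.symm
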